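/- arXiv:2211.14524 — 9 statements merged into one kernel-verified Lean document; each statement's English description precedes it below -/
import Mathlib

section
/- Let G be a group, n ≥ 2 a natural number, and H a subgroup of the direct power Fin n → G (pointwise multiplication) such that the only f ∈ H admitting an index i₀ with f i = 1 for all i ≠ i₀ is the identity. Let F := {g ∈ G | the tuple with value g at index 0, g⁻¹ at index 1, and 1 at all other indices lies in H}. Then F is closed under inverses, and there exists a group homomorphism θ from the subgroup of G generated by F to G such that θ(g) = g⁻¹ for every g ∈ F. In particular, whenever h₁, …, h_k ∈ F satisfy h₁⋯h_k = 1, one also has h₁⁻¹⋯h_k⁻¹ = 1. -/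
/-- The homomorphism placing a pair at the indices `i` and `j` and `1` elsewhere. -/
def pairHom {ι : Type*} [DecidableEq ι] (G : Type*) [Group G] (i j : ι) :
    G × G →* (ι → G) where
  toFun p k := if k = i then p.1 else if k = j then p.2 else 1
  map_one' := by ext k; simp
  map_mul' p q := by ext k; simp only [Prod.fst_mul, Prod.snd_mul, Pi.mul_apply]; split_ifs <;> simp

/-- A subgroup of `G × M` meeting `1 × M` trivially and containing the graph of `f` over `S`
yields an extension of `f` to a homomorphism on the subgroup generated by `S`. -/
theorem exists_monoidHom_closure_of_graph_subset {G M : Type*} [Group G] [Group M]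
    (K : Subgroup (G × M)) (hK : ∀ b, ((1 : G), b) ∈ K → b = 1) (S : Set G) (f : G → M)
    (hf : ∀ g ∈ S, (g, f g) ∈ K) :
    ∃ θ : Subgroup.closure S →* M,
      ∀ (g : G) (hg : g ∈ S), θ ⟨g, Subgroup.subset_closure hg⟩ = f g := by
  have huniq : ∀ a b c, (a, b) ∈ K → (a, c) ∈ K → b = c := fun a b c hb hc =>
    mul_inv_eq_one.mp (hK _ (by simpa using K.mul_mem hb (K.inv_mem hc)))
  have hle : Subgroup.closure S ≤ K.map (MonoidHom.fst G M) :=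
    (Subgroup.closure_le _).mpr fun g hg => ⟨(g, f g), hf g hg, rfl⟩
  have hex : ∀ x : Subgroup.closure S, ∃ b, ((x : G), b) ∈ K := by
    rintro ⟨x, hx⟩
    obtain ⟨⟨a, b⟩, hab, rfl⟩ := hle hx
    exact ⟨b, hab⟩
  choose θ hθ using hex
  exact ⟨MonoidHom.mk' θ fun x y => huniq _ _ _ (hθ (x * y)) (K.mul_mem (hθ x) (hθ y)),
    fun g hg => huniq _ _ _ (hθ _) (hf g hg)⟩

/-- Let `G` be a group, `n ≥ 2`, and `H` a subgroup of the direct power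
`Fin n → G` such that the only `f ∈ H` admitting an index `i₀` with `f i = 1` for all
`i ≠ i₀` is the identity.  Let `F` be the set of `g ∈ G` such that the tuple with value
`g` at index `0`, `g⁻¹` at index `1` and `1` elsewhere lies in `H`.  Then `F` is closed
under inverses, and there is a group homomorphism `θ` from the subgroup generated by `F`
to `G` with `θ g = g⁻¹` for every `g ∈ F`; in particular, whenever `h₁, …, h_k ∈ F`
satisfy `h₁ ⋯ h_k = 1`, one also has `h₁⁻¹ ⋯ h_k⁻¹ = 1`. -/
theorem stmt0 {G : Type*} [Group G] (n : ℕ) (hn : 2 ≤ n)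
    (H : Subgroup (Fin n → G))
    (hH : ∀ f ∈ H, (∃ i₀ : Fin n, ∀ i : Fin n, i ≠ i₀ → f i = 1) → f = 1)
    (F : Set G)
    (hF : F = {g : G |
      (fun i : Fin n =>
        if i = (⟨0, by omega⟩ : Fin n) then g
        else if i = (⟨1, by omega⟩ : Fin n) then g⁻¹ else 1) ∈ H}) :
    (∀ g ∈ F, g⁻¹ ∈ F) ∧
    (∃ θ : Subgroup.closure F →* G,
      ∀ (g : G) (hg : g ∈ F), θ ⟨g, Subgroup.subset_closure hg⟩ = g⁻¹) ∧
    (∀ L : List G, (∀ g ∈ L, g ∈ F) → L.prod = 1 → (L.map fun g => g⁻¹).prod = 1) := by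
  set i : Fin n := ⟨0, by omega⟩
  set j : Fin n := ⟨1, by omega⟩
  have hij : j ≠ i := by simp [i, j]
  let K : Subgroup (G × G) := H.comap (pairHom G i j)
  have hK : ∀ b, ((1 : G), b) ∈ K → b = 1 := fun b hb => by
    have h := hH _ hb ⟨j, fun k hk => by simp [pairHom, hk]⟩
    simpa [pairHom, hij] using congrFun h j
  have hFK : ∀ g, g ∈ F ↔ (g, g⁻¹) ∈ K := fun g => by rw [hF]; rfl
  refine ⟨fun g hg => ?_, ?_, fun L hL hprod => ?_⟩
  · rw [hFK] at hg ⊢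
    exact K.inv_mem hg
  · exact exists_monoidHom_closure_of_graph_subset K hK F _ fun g hg => (hFK g).mp hg
  · have hmem : (L.prod, (L.map fun g => g⁻¹).prod) ∈ K := by
      clear hprod
      induction L with
      | nil => exact K.one_mem
      | cons a L ih =>
        simp only [List.map_cons, List.prod_cons]
        exact K.mul_mem ((hFK a).mp (hL a (by simp))) (ih fun g hg => hL g (by simp [hg]))
    rw [hprod] at hmem
    exact hK _ hmem
end

section
/- Let n ≥ 3, let G be a group, and let θ be an involution of G. In P_n(G), let 𝒢_θ be the subgroup generated by all permutations (with trivial tuple part) together with all elements j_θ(g) (with trivial permutation part). Then 𝒢_θ contains no trivial complex reflexion other than the identity if and only if G is abelian and θ(g) = g⁻¹ for every g ∈ G. -/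
/-- Permutation action of `Equiv.Perm (Fin n)` on the direct power `Fin n → G`:
`(σ • f) i = f (σ⁻¹ i)`. -/
def permAut (G : Type*) [Group G] (n : ℕ) :
    Equiv.Perm (Fin n) →* MulAut (Fin n → G) where
  toFun σ :=
    { toFun := fun f i => f (σ.symm i)
      invFun := fun f i => f (σ i)
      left_inv := fun f => funext fun i => by simp
      right_inv := fun f => funext fun i => by simp
      map_mul' := fun f g => rfl }
  map_one' := rfl
  map_mul' := fun σ τ => rfl

/-- `P_n(G) = (Fin n → G) ⋊ Equiv.Perm (Fin n)`. -/
abbrev Pn (G : Type*) [Group G] (n : ℕ) :=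
  SemidirectProduct (Fin n → G) (Equiv.Perm (Fin n)) (permAut G n)

/-- For commutative `G`, the homomorphism `P_n(G) → G` multiplying the entries of the tuple. -/
def Pn.tupleProd (G : Type*) [CommGroup G] (n : ℕ) : Pn G n →* G where
  toFun x := ∏ i, x.left i
  map_one' := by simp
  map_mul' x y := by
    have h : ∏ i, permAut G n x.right y.left i = ∏ i, y.left i :=
      Equiv.prod_comp x.right.symm y.left
    simp [Finset.prod_mul_distrib, h]

/-- A subgroup of `P_n(G)` containing all permutations is stable under permuting coordinates. -/
lemma Pn.inl_permAut_mem {G : Type*} [Group G] {n : ℕ} {H : Subgroup (Pn G n)}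
    (hH : ∀ σ : Equiv.Perm (Fin n), (SemidirectProduct.inr σ : Pn G n) ∈ H)
    (σ : Equiv.Perm (Fin n)) {f : Fin n → G} (hf : (SemidirectProduct.inl f : Pn G n) ∈ H) :
    (SemidirectProduct.inl (permAut G n σ f) : Pn G n) ∈ H := by
  rw [SemidirectProduct.inl_aut]
  exact H.mul_mem (H.mul_mem (hH σ) hf) (hH σ⁻¹)

/-- In commutative `G`, elements generated by permutations and the tuples
`(g, g⁻¹, 1, …, 1)` have entries with product `1`. -/
lemma Pn.tupleProd_eq_one_of_mem_closure {G : Type*} [CommGroup G] {n : ℕ} {a b : Fin n}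
    (hab : a ≠ b) {θ : G → G} (hθ : ∀ g, θ g = g⁻¹) {x : Pn G n}
    (hx : x ∈ Subgroup.closure
      ((Set.range fun σ : Equiv.Perm (Fin n) => (SemidirectProduct.inr σ : Pn G n)) ∪
       (Set.range fun g : G => (SemidirectProduct.inl (fun i : Fin n =>
         if i = a then g else if i = b then θ g else 1) : Pn G n)))) :
    Pn.tupleProd G n x = 1 := by
  rw [← MonoidHom.mem_ker]
  refine (Subgroup.closure_le _).2 ?_ hx
  rintro _ (⟨σ, rfl⟩ | ⟨g, rfl⟩)
  · simp [Pn.tupleProd, MonoidHom.mem_ker]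
  · simp only [SetLike.mem_coe, MonoidHom.mem_ker, Pn.tupleProd, MonoidHom.coe_mk, OneHom.coe_mk,
      SemidirectProduct.left_inl]
    rw [Finset.prod_eq_mul a b hab]
    · simp [hab.symm, hθ]
    · rintro c - ⟨hca, hcb⟩
      simp [hca, hcb]
    · simp
    · simp

/-- Let `n ≥ 3`, `G` a group and `θ` an involution of `G`.  In `P_n(G)`,
let `𝒢` be the subgroup generated by all permutations (with trivial tuple part) together
with all elements `j_θ(g)` (with trivial permutation part), where `j_θ(g)` is the tuple
with value `g` at index `0`, `θ g` at index `1` and `1` elsewhere.  Then `𝒢` contains no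
trivial complex reflexion other than the identity if and only if `G` is abelian and
`θ g = g⁻¹` for every `g ∈ G`. -/
theorem stmt2 {G : Type*} [Group G] (n : ℕ) (hn : 3 ≤ n)
    (θ : G →* G) (hθ : ∀ g : G, θ (θ g) = g)
    (𝒢 : Subgroup (Pn G n))
    (h𝒢 : 𝒢 = Subgroup.closure
      ((Set.range fun σ : Equiv.Perm (Fin n) => (SemidirectProduct.inr σ : Pn G n)) ∪
       (Set.range fun g : G =>
         (SemidirectProduct.inl (fun i : Fin n =>
           if i = (⟨0, by omega⟩ : Fin n) then g
           else if i = (⟨1, by omega⟩ : Fin n) then θ g else 1) : Pn G n)))) :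
    (∀ x ∈ 𝒢, x.right = 1 →
        (∃ i₀ : Fin n, ∀ i : Fin n, i ≠ i₀ → x.left i = 1) → x = 1) ↔
      ((∀ a b : G, a * b = b * a) ∧ ∀ g : G, θ g = g⁻¹) := by
  subst h𝒢
  constructor
  · intro h
    set a : Fin n := ⟨0, by omega⟩
    set b : Fin n := ⟨1, by omega⟩
    let c : Fin n := ⟨2, by omega⟩
    have hab : a ≠ b := by simp [a, b]
    have hac : a ≠ c := by simp [a, c]
    have hbc : b ≠ c := by simp [b, c]
    let j (g : G) : Fin n → G := fun i => if i = a then g else if i = b then θ g else 1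
    set H := Subgroup.closure
      ((Set.range fun σ : Equiv.Perm (Fin n) => (SemidirectProduct.inr σ : Pn G n)) ∪
       (Set.range fun g : G => (SemidirectProduct.inl (j g) : Pn G n)))
    have hperm (σ : Equiv.Perm (Fin n)) : (SemidirectProduct.inr σ : Pn G n) ∈ H :=
      Subgroup.subset_closure (Or.inl ⟨σ, rfl⟩)
    have hj (g : G) : (SemidirectProduct.inl (j g) : Pn G n) ∈ H :=
      Subgroup.subset_closure (Or.inr ⟨g, rfl⟩)
    have hinv (g : G) : θ g = g⁻¹ := by
      -- `u` has entries `g, θ g` at `a, c`; `v` has entries `(θ g)⁻¹, g⁻¹` at `c, b`.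
      let u := permAut G n (Equiv.swap b c) (j g)
      let v := permAut G n (Equiv.swap a c) (j (θ g)⁻¹)
      have hu (i : Fin n) : u i = j g (Equiv.swap b c i) := rfl
      have hv (i : Fin n) : v i = j (θ g)⁻¹ (Equiv.swap a c i) := rfl
      let w := (u * v)⁻¹ * j g
      have hw : (SemidirectProduct.inl w : Pn G n) ∈ H := by
        simp only [w, map_mul, map_inv]
        exact H.mul_mem (H.inv_mem (H.mul_mem (Pn.inl_permAut_mem hperm _ (hj _))
          (Pn.inl_permAut_mem hperm _ (hj _)))) (hj g)
      have hone : (SemidirectProduct.inl w : Pn G n) = 1 := by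
        refine h _ hw rfl ⟨b, fun i hi => ?_⟩
        by_cases hia : i = a
        · subst hia
          simp [w, hu, hv, j, Equiv.swap_apply_of_ne_of_ne hab hac, hac.symm, hbc.symm]
        by_cases hic : i = c
        · subst hic
          simp [w, hu, hv, j, hab.symm, hac.symm, hbc.symm]
        simp [w, hu, hv, j, Equiv.swap_apply_of_ne_of_ne hi hic,
          Equiv.swap_apply_of_ne_of_ne hia hic, hia, hi]
      have hwb : w b = 1 := congrFun (congrArg SemidirectProduct.left hone) b
      simp only [w, hu, hv, j, Pi.mul_apply, Pi.inv_apply, Equiv.swap_apply_left,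
        Equiv.swap_apply_of_ne_of_ne hab.symm hbc, hab.symm, hac.symm, hbc.symm, if_true,
        if_false, map_inv, hθ, one_mul, inv_inv] at hwb
      exact eq_inv_of_mul_eq_one_right hwb
    refine ⟨fun x y => ?_, hinv⟩
    have hxy := map_mul θ x⁻¹ y⁻¹
    simp only [hinv, mul_inv_rev, inv_inv] at hxy
    exact hxy.symm
  · rintro ⟨hcomm, hinv⟩ x hx hright ⟨i₀, hi₀⟩
    let _ : CommGroup G := { ‹Group G› with mul_comm := hcomm }
    have hprod : ∏ i, x.left i = 1 :=
      Pn.tupleProd_eq_one_of_mem_closure (by simp) hinv hx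
    rw [Finset.prod_eq_single i₀ (fun i _ hi => hi₀ i hi) (by simp)] at hprod
    refine SemidirectProduct.ext (funext fun i => ?_) hright
    by_cases hi : i = i₀
    · exact hi ▸ hprod
    · exact hi₀ i hi
end

section
/- Let n ≥ 2, let G be a finite group, and let θ be an involution of G. In P_n(G), let 𝒢_θ be the subgroup generated by all permutations (with trivial tuple part) together with all elements j_θ(g) (with trivial permutation part). If 𝒢_θ contains no trivial complex reflexion other than the identity, then the cardinality of 𝒢_θ equals |G|^(n−1) · n!. -/
theorem permAut_apply {G : Type*} [Group G] {n : ℕ} (σ : Equiv.Perm (Fin n)) (f : Fin n → G)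
    (i : Fin n) : permAut G n σ f i = f (σ.symm i) :=
  rfl

/-- A subgroup of `P_n(G)` containing all permutations is, as a set, the product of its
intersection with the base group and the full symmetric group. -/
def subgroupEquivBaseProdPerm {G : Type*} [Group G] {n : ℕ} (H : Subgroup (Pn G n))
    (hperm : ∀ σ : Equiv.Perm (Fin n), (SemidirectProduct.inr σ : Pn G n) ∈ H) :
    H ≃ (H.comap (SemidirectProduct.inl : (Fin n → G) →* Pn G n)) × Equiv.Perm (Fin n) where
  toFun x := (⟨x.1.left, by
    rw [Subgroup.mem_comap, ← H.mul_mem_cancel_right (hperm x.1.right),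
      SemidirectProduct.inl_left_mul_inr_right]
    exact x.2⟩, x.1.right)
  invFun p := ⟨SemidirectProduct.inl p.1.1 * SemidirectProduct.inr p.2,
    H.mul_mem p.1.2 (hperm p.2)⟩
  left_inv x := Subtype.ext (SemidirectProduct.inl_left_mul_inr_right x.1)
  right_inv p := by ext <;> simp

/-- Restriction of tuples to the indices different from `a`. -/
def restrictNe (G : Type*) [Group G] {ι : Type*} (a : ι) : (ι → G) →* ({i // i ≠ a} → G) where
  toFun f i := f i
  map_one' := rfl
  map_mul' _ _ := rfl

theorem restrictNe_apply {G ι : Type*} [Group G] (a : ι) (f : ι → G) (i : {i // i ≠ a}) :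
    restrictNe G a f i = f i :=
  rfl

/-- If a subgroup of tuples contains no nontrivial tuple supported at `a`, and contains for every
`i ≠ a` and `g` a tuple which agrees with `Pi.mulSingle i g` away from `a`, then
it has `|G| ^ (|ι| - 1)` elements. -/
theorem card_subgroup_pi_of_restrictNe {G ι : Type*} [Group G] [Fintype ι] [DecidableEq ι]
    (a : ι) (N : Subgroup (ι → G))
    (hinj : ∀ f ∈ N, (∀ i, i ≠ a → f i = 1) → f = 1)
    (hsurj : ∀ (i : {i // i ≠ a}) (g : G), ∃ f ∈ N, restrictNe G a f = Pi.mulSingle i g) :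
    Nat.card N = Nat.card G ^ (Fintype.card ι - 1) := by
  have hbij : Function.Bijective ((restrictNe G a).comp N.subtype) := by
    constructor
    · rw [injective_iff_map_eq_one]
      intro f hf
      exact Subtype.ext (hinj f f.2 fun i hi => congrFun hf ⟨i, hi⟩)
    · rw [← MonoidHom.range_eq_top, eq_top_iff]
      intro h _
      refine Subgroup.pi_mem_of_mulSingle_mem h fun i => ?_
      obtain ⟨f, hf, hfi⟩ := hsurj i (h i)
      exact ⟨⟨f, hf⟩, hfi⟩
  rw [Nat.card_congr (Equiv.ofBijective _ hbij), Nat.card_fun,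
    Nat.card_eq_fintype_card (α := {i // i ≠ a}), Fintype.card_subtype_compl, Fintype.card_subtype_eq]

/-- Let `n ≥ 2`, `G` a finite group and `θ` an involution of `G`.  In
`P_n(G)`, let `𝒢` be the subgroup generated by all permutations (with trivial tuple part)
together with all elements `j_θ(g)` (with trivial permutation part).  If `𝒢` contains no
trivial complex reflexion other than the identity, then `|𝒢| = |G|^(n-1) · n!`. -/
theorem stmt3 {G : Type*} [Group G] [Finite G] (n : ℕ) (hn : 2 ≤ n)
    (θ : G →* G) (hθ : ∀ g : G, θ (θ g) = g)
    (𝒢 : Subgroup (Pn G n))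
    (h𝒢 : 𝒢 = Subgroup.closure
      ((Set.range fun σ : Equiv.Perm (Fin n) => (SemidirectProduct.inr σ : Pn G n)) ∪
       (Set.range fun g : G =>
         (SemidirectProduct.inl (fun i : Fin n =>
           if i = (⟨0, by omega⟩ : Fin n) then g
           else if i = (⟨1, by omega⟩ : Fin n) then θ g else 1) : Pn G n))))
    (hfree : ∀ x ∈ 𝒢, x.right = 1 →
        (∃ i₀ : Fin n, ∀ i : Fin n, i ≠ i₀ → x.left i = 1) → x = 1) :
    Nat.card 𝒢 = Nat.card G ^ (n - 1) * Nat.factorial n := by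
  have hperm (σ : Equiv.Perm (Fin n)) : (SemidirectProduct.inr σ : Pn G n) ∈ 𝒢 := by
    rw [h𝒢]
    exact Subgroup.subset_closure (Or.inl ⟨σ, rfl⟩)
  have hcard := card_subgroup_pi_of_restrictNe (⟨0, by omega⟩ : Fin n)
    (𝒢.comap (SemidirectProduct.inl : (Fin n → G) →* Pn G n))
    (fun f hf h => SemidirectProduct.inl_injective
      ((hfree _ hf rfl ⟨_, h⟩).trans (map_one _).symm))
    (by
      rintro ⟨i, hi⟩ g
      let σ : Equiv.Perm (Fin n) :=
        Equiv.swap ⟨0, by omega⟩ i * Equiv.swap ⟨1, by omega⟩ i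
      have hσ0 : σ ⟨0, by omega⟩ = i := by
        simp [σ, Equiv.swap_apply_of_ne_of_ne (a := (⟨1, by omega⟩ : Fin n)) (b := i)
          (x := ⟨0, by omega⟩) (by simp) hi.symm]
      have hσ1 : σ ⟨1, by omega⟩ = ⟨0, by omega⟩ := by simp [σ]
      refine ⟨permAut G n σ fun k => if k = (⟨0, by omega⟩ : Fin n) then g
        else if k = (⟨1, by omega⟩ : Fin n) then θ g else 1, ?_, ?_⟩
      · rw [Subgroup.mem_comap, SemidirectProduct.inl_aut]
        refine 𝒢.mul_mem (𝒢.mul_mem (hperm σ) ?_) (hperm σ⁻¹)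
        rw [h𝒢]
        exact Subgroup.subset_closure (Or.inr ⟨g, rfl⟩)
      · ext ⟨k, hk⟩
        simp [restrictNe_apply, permAut_apply, Equiv.symm_apply_eq, hσ0, hσ1, hk,
          Pi.mulSingle_apply])
  rw [Nat.card_congr (subgroupEquivBaseProdPerm 𝒢 hperm), Nat.card_prod, hcard, Nat.card_perm,
    Nat.card_fin, Fintype.card_fin]
end

section
/- Let G̃ be a group, G a subgroup of G̃, and θ₁, θ₂ involutions of G. Suppose h₁, h₂ ∈ G̃ satisfy: (i) h₁Gh₁⁻¹ = G and h₂Gh₂⁻¹ = G; (ii) h₁·h₂⁻¹ ∈ G; (iii) θ₂(h₁·h₂⁻¹) = h₂·h₁⁻¹; (iv) θ₂(h₁·g·h₁⁻¹) = h₂·θ₁(g)·h₂⁻¹ for all g ∈ G. In W(G̃), let 𝒢_i (for i = 1, 2) be the subgroup generated by the swap element ((1,1), σ) together with all elements ((g, θ_i(g)), 0) for g ∈ G. Then conjugation by the element ((h₁, h₂), 0) maps 𝒢₁ into 𝒢₂. -/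
/-- `W(Γ) = (Γ × Γ) ⋊ C₂`, encoded as `(Fin 2 → Γ) ⋊ Equiv.Perm (Fin 2)`, where the
nontrivial element `σ = Equiv.swap 0 1` acts by exchanging the two factors.  An element
`((u, v), ε)` is `⟨![u, v], ε⟩`. -/
abbrev W (Γ : Type*) [Group Γ] :=
  SemidirectProduct (Fin 2 → Γ) (Equiv.Perm (Fin 2)) (permAut Γ 2)

/-- Let `Γ` be a group, `G ≤ Γ`, and `θ₁, θ₂` involutions of `G`.
Suppose `h₁, h₂ ∈ Γ` satisfy: (i) `h₁Gh₁⁻¹ = G` and `h₂Gh₂⁻¹ = G`;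
(ii) `h₁h₂⁻¹ ∈ G`; (iii) `θ₂(h₁h₂⁻¹) = h₂h₁⁻¹`; (iv) `θ₂(h₁gh₁⁻¹) = h₂ θ₁(g) h₂⁻¹`
for all `g ∈ G`.  In `W(Γ)`, let `𝒢ᵢ` be the subgroup generated by the swap element
`((1,1), σ)` together with all elements `((g, θᵢ g), 0)` for `g ∈ G`.  Then conjugation
by `((h₁, h₂), 0)` maps `𝒢₁` into `𝒢₂`. -/
theorem stmt5 {Γ : Type*} [Group Γ] (G : Subgroup Γ)
    (θ₁ θ₂ : G →* G) (hθ₁ : ∀ g : G, θ₁ (θ₁ g) = g) (hθ₂ : ∀ g : G, θ₂ (θ₂ g) = g)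
    (h₁ h₂ : Γ)
    (hconj₁ : ∀ x : Γ, x ∈ G ↔ h₁ * x * h₁⁻¹ ∈ G)
    (hconj₂ : ∀ x : Γ, x ∈ G ↔ h₂ * x * h₂⁻¹ ∈ G)
    (h12 : h₁ * h₂⁻¹ ∈ G)
    (hiii : (θ₂ ⟨h₁ * h₂⁻¹, h12⟩ : Γ) = h₂ * h₁⁻¹)
    (hiv : ∀ (g : Γ) (hg : g ∈ G) (hg' : h₁ * g * h₁⁻¹ ∈ G),
      (θ₂ ⟨h₁ * g * h₁⁻¹, hg'⟩ : Γ) = h₂ * (θ₁ ⟨g, hg⟩ : Γ) * h₂⁻¹)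
    (𝒢₁ 𝒢₂ : Subgroup (W Γ))
    (h𝒢₁ : 𝒢₁ = Subgroup.closure
      ({SemidirectProduct.inr (Equiv.swap 0 1)} ∪
        Set.range fun g : G => (SemidirectProduct.inl ![(g : Γ), (θ₁ g : Γ)] : W Γ)))
    (h𝒢₂ : 𝒢₂ = Subgroup.closure
      ({SemidirectProduct.inr (Equiv.swap 0 1)} ∪
        Set.range fun g : G => (SemidirectProduct.inl ![(g : Γ), (θ₂ g : Γ)] : W Γ))) :
    ∀ x ∈ 𝒢₁,
      SemidirectProduct.inl ![h₁, h₂] * x * (SemidirectProduct.inl ![h₁, h₂])⁻¹ ∈ 𝒢₂ := by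
  subst h𝒢₁ h𝒢₂
  intro x hx
  induction hx using Subgroup.closure_induction with
  | mem x hx =>
    rcases hx with rfl | ⟨g, rfl⟩
    · have key : (SemidirectProduct.inl ![h₁, h₂] * SemidirectProduct.inr (Equiv.swap 0 1) *
          (SemidirectProduct.inl ![h₁, h₂])⁻¹ : W Γ) =
          SemidirectProduct.inl ![h₁ * h₂⁻¹, (θ₂ ⟨h₁ * h₂⁻¹, h12⟩ : Γ)] *
            SemidirectProduct.inr (Equiv.swap 0 1) := by
        rw [hiii]
        ext i
        · fin_cases i <;> simp [permAut_apply]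
        · simp
      rw [key]
      exact mul_mem (Subgroup.subset_closure (Or.inr ⟨⟨h₁ * h₂⁻¹, h12⟩, rfl⟩))
        (Subgroup.subset_closure (Or.inl rfl))
    · have hg : h₁ * (g : Γ) * h₁⁻¹ ∈ G := (hconj₁ g).1 g.2
      refine Subgroup.subset_closure (Or.inr ⟨⟨h₁ * g * h₁⁻¹, hg⟩, ?_⟩)
      simp only [hiv g g.2 hg, ← map_inv, ← map_mul]
      congr 1
      ext i
      fin_cases i <;> simp
  | one => simp
  | mul x y _ _ hx hy => simpa [mul_assoc] using mul_mem hx hy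
  | inv x _ hx => simpa [mul_assoc] using inv_mem hx
end

section
/- Let a group G act on a set S, let θ be an involution of G, and let g ∈ G be such that every h ∈ G with ⟨h⟩ = ⟨g⟩ satisfies h = g or h = g⁻¹ (this holds for instance when g has order 1, 2, 3, 4 or 6). Let x ∈ S be a point whose stabilizer equals ⟨g⟩. Define 𝒮_g := {s ∈ G | s⁻¹·θ(g)·s = g or s⁻¹·θ(g)·s = g⁻¹}. Then the assignment s ↦ s • x induces a well-defined bijection from the set of right cosets {s·⟨g⟩ | s ∈ 𝒮_g} onto the set {y ∈ S | (∃ s ∈ G, y = s • x) and the stabilizer of y equals ⟨θ(g)⟩}. -/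
open Pointwise in
/-- Two points of the orbit of `x` agree iff the corresponding left cosets of the stabilizer do. -/
theorem smul_eq_smul_iff_image_stabilizer_eq {G S : Type*} [Group G] [MulAction G S]
    (x : S) (s t : G) :
    s • x = t • x ↔
      (fun z => s * z) '' (MulAction.stabilizer G x : Set G) =
        (fun z => t * z) '' (MulAction.stabilizer G x : Set G) := by
  change _ ↔ s • (MulAction.stabilizer G x : Set G) = t • (MulAction.stabilizer G x : Set G)
  rw [leftCoset_eq_iff, MulAction.mem_stabilizer_iff, mul_smul, inv_smul_eq_iff, eq_comm]

/-- If `x` has stabilizer `⟨g⟩`, then `s • x` has stabilizer `⟨k⟩` iff `s⁻¹ * k * s`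
generates `⟨g⟩`. -/
theorem stabilizer_smul_eq_zpowers_iff {G S : Type*} [Group G] [MulAction G S]
    {x : S} {g : G} (hx : MulAction.stabilizer G x = Subgroup.zpowers g) (s k : G) :
    MulAction.stabilizer G (s • x) = Subgroup.zpowers k ↔
      Subgroup.zpowers (s⁻¹ * k * s) = Subgroup.zpowers g := by
  have hk : Subgroup.zpowers k =
      (Subgroup.zpowers (s⁻¹ * k * s)).map (MulAut.conj s).toMonoidHom := by
    rw [MonoidHom.map_zpowers]
    simp [mul_assoc]
  rw [MulAction.stabilizer_smul_eq_stabilizer_map_conj, hx, hk,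
    (Subgroup.map_injective (MulAut.conj s).injective).eq_iff, eq_comm]

/-- Let a group `G` act on a set `S`, `θ` an involution of `G`, and
`g ∈ G` such that every `h` with `⟨h⟩ = ⟨g⟩` satisfies `h = g` or `h = g⁻¹`.  Let
`x ∈ S` have stabilizer exactly `⟨g⟩`, and let
`𝒮_g = {s ∈ G | s⁻¹ θ(g) s = g or s⁻¹ θ(g) s = g⁻¹}`.  Then `s ↦ s • x` induces a
well-defined bijection from the set of right cosets `{s⟨g⟩ | s ∈ 𝒮_g}` onto the set of
points `y` of the orbit of `x` whose stabilizer equals `⟨θ g⟩`. -/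
theorem stmt7 {G S : Type*} [Group G] [MulAction G S]
    (θ : G →* G) (hθ : ∀ a : G, θ (θ a) = a)
    (g : G) (hg : ∀ h : G, Subgroup.zpowers h = Subgroup.zpowers g → h = g ∨ h = g⁻¹)
    (x : S) (hx : MulAction.stabilizer G x = Subgroup.zpowers g)
    (Sg : Set G)
    (hSg : Sg = {s : G | s⁻¹ * θ g * s = g ∨ s⁻¹ * θ g * s = g⁻¹}) :
    ∃ e : {C : Set G // ∃ s ∈ Sg, C = (fun z => s * z) '' (Subgroup.zpowers g : Set G)} ≃
          {y : S // (∃ s : G, y = s • x) ∧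
            MulAction.stabilizer G y = Subgroup.zpowers (θ g)},
      ∀ (s : G) (hs : s ∈ Sg),
        (e ⟨(fun z => s * z) '' (Subgroup.zpowers g : Set G), s, hs, rfl⟩ : S)
          = s • x := by
  have mem_iff (s : G) :
      s ∈ Sg ↔ MulAction.stabilizer G (s • x) = Subgroup.zpowers (θ g) := by
    rw [stabilizer_smul_eq_zpowers_iff hx, hSg]
    refine ⟨?_, hg _⟩
    rintro (h | h) <;> rw [h]
    exact Subgroup.zpowers_inv
  have coset_iff (s t : G) := smul_eq_smul_iff_image_stabilizer_eq x s t
  simp only [hx] at coset_iff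
  let F : {C : Set G // ∃ s ∈ Sg, C = (fun z => s * z) '' (Subgroup.zpowers g : Set G)} →
      {y : S // (∃ s : G, y = s • x) ∧
        MulAction.stabilizer G y = Subgroup.zpowers (θ g)} :=
    fun C => ⟨C.2.choose • x, ⟨_, rfl⟩, (mem_iff _).1 C.2.choose_spec.1⟩
  have F_coset (s : G) (hs : s ∈ Sg) :
      (F ⟨(fun z => s * z) '' (Subgroup.zpowers g : Set G), s, hs, rfl⟩ : S) = s • x :=
    (coset_iff _ _).2 (Subtype.property
      (⟨_, s, hs, rfl⟩ : {C : Set G // ∃ s ∈ Sg,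
        C = (fun z => s * z) '' (Subgroup.zpowers g : Set G)})).choose_spec.2.symm
  refine ⟨Equiv.ofBijective F ⟨?_, ?_⟩, F_coset⟩
  · rintro ⟨_, s, hs, rfl⟩ ⟨_, t, ht, rfl⟩ h
    have h' := congrArg Subtype.val h
    rw [F_coset s hs, F_coset t ht] at h'
    exact Subtype.ext ((coset_iff s t).1 h')
  · rintro ⟨_, ⟨s, rfl⟩, hs⟩
    exact ⟨⟨_, s, (mem_iff s).2 hs, rfl⟩, Subtype.ext (F_coset s ((mem_iff s).2 hs))⟩
end

section
/- Let a group G act on a set S and let θ be an involution of G. Let g, g_i, g_j ∈ G satisfy ⟨g_i⟩ ⊓ ⟨g_j⟩ = ⟨g⟩, let s ∈ G satisfy s⁻¹·θ(g_j)·s = g_i or s⁻¹·θ(g_j)·s = g_i⁻¹, and let x ∈ S be a point whose stabilizer equals ⟨g_i⟩. Then: (a) for every α ∈ G, one has (α • x = x and θ(α) • (s • x) = s • x) if and only if α ∈ ⟨g⟩; (b) for every h ∈ G, one has (h • x = s • x and θ(h) • (s • x) = x) if and only if (s⁻¹·h ∈ ⟨g_i⟩ and θ(h)·s ∈ ⟨g_i⟩).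 -/
/-- Let a group `G` act on a set `S` and let `θ` be an involution of
`G`.  Let `g, gᵢ, gⱼ ∈ G` satisfy `⟨gᵢ⟩ ⊓ ⟨gⱼ⟩ = ⟨g⟩`, let `s ∈ G` satisfy
`s⁻¹ θ(gⱼ) s = gᵢ` or `s⁻¹ θ(gⱼ) s = gᵢ⁻¹`, and let `x ∈ S` have stabilizer `⟨gᵢ⟩`.
Then: (a) for every `α ∈ G`, `(α • x = x ∧ θ(α) • (s • x) = s • x) ↔ α ∈ ⟨g⟩`;
(b) for every `h ∈ G`, `(h • x = s • x ∧ θ(h) • (s • x) = x) ↔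
(s⁻¹h ∈ ⟨gᵢ⟩ ∧ θ(h)s ∈ ⟨gᵢ⟩)`. -/
theorem stmt9 {G S : Type*} [Group G] [MulAction G S]
    (θ : G →* G) (hθ : ∀ a : G, θ (θ a) = a)
    (g gi gj : G)
    (hgij : Subgroup.zpowers gi ⊓ Subgroup.zpowers gj = Subgroup.zpowers g)
    (s : G) (hs : s⁻¹ * θ gj * s = gi ∨ s⁻¹ * θ gj * s = gi⁻¹)
    (x : S) (hx : MulAction.stabilizer G x = Subgroup.zpowers gi) :
    (∀ α : G, (α • x = x ∧ θ α • (s • x) = s • x) ↔ α ∈ Subgroup.zpowers g) ∧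
    (∀ h : G, (h • x = s • x ∧ θ h • (s • x) = x) ↔
      (s⁻¹ * h ∈ Subgroup.zpowers gi ∧ θ h * s ∈ Subgroup.zpowers gi)) := by
  have mem_iff (a : G) : a ∈ Subgroup.zpowers gi ↔ a • x = x := by
    rw [← hx, MulAction.mem_stabilizer_iff]
  -- `f` is the injective homomorphism `a ↦ s⁻¹ * θ a * s`.
  let f : G →* G := (MulAut.conj s⁻¹).toMonoidHom.comp θ
  have f_apply (a : G) : f a = s⁻¹ * θ a * s := by simp [f]
  have f_injective : Function.Injective f :=
    (MulAut.conj s⁻¹).injective.comp (Function.LeftInverse.injective hθ)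
  have map_f : (Subgroup.zpowers gj).map f = Subgroup.zpowers gi := by
    rw [MonoidHom.map_zpowers, f_apply]
    rcases hs with h | h <;> rw [h]
    exact Subgroup.zpowers_inv
  refine ⟨fun α => ?_, fun h => ?_⟩
  · rw [← hgij, Subgroup.mem_inf, mem_iff, ← Subgroup.mem_map_iff_mem f_injective, map_f,
      mem_iff, f_apply, mul_smul, mul_smul, inv_smul_eq_iff]
  · rw [mem_iff, mem_iff, mul_smul, mul_smul, inv_smul_eq_iff]
end

section
/- Let a group G act on a set S and let θ be an involution of G. Let g, g_i, g_j ∈ G satisfy ⟨g_i⟩ ⊓ ⟨g_j⟩ = ⟨g⟩, let s ∈ G satisfy s⁻¹·θ(g_j)·s = g_i or s⁻¹·θ(g_j)·s = g_i⁻¹, and let x ∈ S be a point whose stabilizer equals ⟨g_i⟩. Define H := {h ∈ G | h • x = s • x and θ(h) • (s • x) = x}. Then: (1) H is nonempty if and only if there exists an integer k such that θ(s·g_i^k)·(s·g_i^k) ∈ ⟨g⟩; (2) for every h ∈ H, one has H = {h·z | z ∈ ⟨g⟩}. -/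
/-- If `s⁻¹ θ(b) s = a^{±1}`, then `z ↦ s⁻¹ θ(z) s` pulls `⟨a⟩` back to `⟨b⟩`. -/
theorem conj_map_mem_zpowers_iff {G : Type*} [Group G] {θ : G →* G}
    (hθ : Function.Injective θ) {a b s : G}
    (hs : s⁻¹ * θ b * s = a ∨ s⁻¹ * θ b * s = a⁻¹) (z : G) :
    s⁻¹ * θ z * s ∈ Subgroup.zpowers a ↔ z ∈ Subgroup.zpowers b := by
  let f : G →* G := (MulAut.conj s⁻¹).toMonoidHom.comp θ
  have hf : ∀ y, f y = s⁻¹ * θ y * s := fun y => by simp [f]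
  have hinj : Function.Injective f := (MulAut.conj s⁻¹).injective.comp hθ
  have hz : Subgroup.zpowers a = (Subgroup.zpowers b).map f := by
    rw [MonoidHom.map_zpowers, hf]
    rcases hs with h | h <;> simp [h]
  rw [hz, ← hf, Subgroup.mem_map_iff_mem hinj]

/-- Let a group `G` act on a set `S` and let `θ` be an involution of
`G`.  Let `g, gᵢ, gⱼ ∈ G` satisfy `⟨gᵢ⟩ ⊓ ⟨gⱼ⟩ = ⟨g⟩`, let `s ∈ G` satisfy
`s⁻¹ θ(gⱼ) s = gᵢ` or `s⁻¹ θ(gⱼ) s = gᵢ⁻¹`, and let `x ∈ S` have stabilizer `⟨gᵢ⟩`.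
Set `H := {h ∈ G | h • x = s • x ∧ θ(h) • (s • x) = x}`.  Then: (1) `H` is nonempty iff
there is an integer `k` with `θ(s gᵢᵏ) (s gᵢᵏ) ∈ ⟨g⟩`; (2) for every `h ∈ H`,
`H = {h z | z ∈ ⟨g⟩}`. -/
theorem stmt10 {G S : Type*} [Group G] [MulAction G S]
    (θ : G →* G) (hθ : ∀ a : G, θ (θ a) = a)
    (g gi gj : G)
    (hgij : Subgroup.zpowers gi ⊓ Subgroup.zpowers gj = Subgroup.zpowers g)
    (s : G) (hs : s⁻¹ * θ gj * s = gi ∨ s⁻¹ * θ gj * s = gi⁻¹)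
    (x : S) (hx : MulAction.stabilizer G x = Subgroup.zpowers gi)
    (H : Set G)
    (hH : H = {h : G | h • x = s • x ∧ θ h • (s • x) = x}) :
    (H.Nonempty ↔ ∃ k : ℤ, θ (s * gi ^ k) * (s * gi ^ k) ∈ Subgroup.zpowers g) ∧
    (∀ h ∈ H, H = {y : G | ∃ z ∈ Subgroup.zpowers g, y = h * z}) := by
  have hinj : Function.Injective θ := Function.LeftInverse.injective hθ
  have hstab : ∀ a : G, a • x = x ↔ a ∈ Subgroup.zpowers gi := fun a => by
    rw [← hx, MulAction.mem_stabilizer_iff]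
  have hconj : ∀ c ∈ Subgroup.zpowers gi, ∀ z : G,
      (s * c)⁻¹ * θ z * (s * c) ∈ Subgroup.zpowers gi ↔ z ∈ Subgroup.zpowers gj := by
    intro c hc z
    rw [← conj_map_mem_zpowers_iff hinj hs z,
      show (s * c)⁻¹ * θ z * (s * c) = c⁻¹ * (s⁻¹ * θ z * s) * c by group,
      Subgroup.mul_mem_cancel_right _ hc, Subgroup.mul_mem_cancel_left _ (inv_mem hc)]
  have hmem : ∀ h : G, h ∈ H ↔
      s⁻¹ * h ∈ Subgroup.zpowers gi ∧ θ h * h ∈ Subgroup.zpowers gi := by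
    intro h
    rw [hH, Set.mem_ofPred_eq, ← hstab, ← hstab, mul_smul, mul_smul, inv_smul_eq_iff]
    exact and_congr_right fun e => by rw [e]
  have hswap : ∀ c ∈ Subgroup.zpowers gi, θ (s * c) * (s * c) ∈ Subgroup.zpowers gi →
      θ (s * c) * (s * c) ∈ Subgroup.zpowers g := by
    intro c hc hu
    rw [← hgij]
    refine ⟨hu, (hconj c hc _).1 ?_⟩
    rw [map_mul θ (θ (s * c)), hθ]
    rwa [inv_mul_cancel_left]
  refine ⟨⟨?_, ?_⟩, ?_⟩
  · rintro ⟨h, hh⟩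
    obtain ⟨hc, hu⟩ := (hmem h).1 hh
    obtain ⟨k, hk⟩ := Subgroup.mem_zpowers_iff.1 hc
    obtain rfl : h = s * gi ^ k := by rw [hk, mul_inv_cancel_left]
    exact ⟨k, hswap _ (Subgroup.zpow_mem_zpowers gi k) hu⟩
  · rintro ⟨k, hk⟩
    refine ⟨s * gi ^ k, (hmem _).2 ⟨?_, (hgij.ge hk).1⟩⟩
    rw [inv_mul_cancel_left]
    exact Subgroup.zpow_mem_zpowers gi k
  · intro h hh
    obtain ⟨hc, hu⟩ := (hmem h).1 hh
    have key : ∀ z : G, h * z ∈ H ↔ z ∈ Subgroup.zpowers g := by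
      intro z
      rw [hmem, ← hgij, Subgroup.mem_inf, ← mul_assoc, Subgroup.mul_mem_cancel_left _ hc]
      refine and_congr_right fun hz => ?_
      have hz' := hconj _ hc z
      rw [mul_inv_cancel_left] at hz'
      rw [← hz', map_mul,
        show θ h * θ z * (h * z) = θ h * h * (h⁻¹ * θ z * h) * z by group,
        Subgroup.mul_mem_cancel_right _ hz, Subgroup.mul_mem_cancel_left _ hu]
    ext y
    constructor
    · intro hy
      exact ⟨h⁻¹ * y, (key _).1 (by rwa [mul_inv_cancel_left]), by rw [mul_inv_cancel_left]⟩
    · rintro ⟨z, hz, rfl⟩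
      exact (key z).2 hz
end

section
/- Let n ≥ 1 be an integer and let ζ ∈ ℂ be a primitive (2n)-th root of unity. Let g := diag(ζ, ζ⁻¹, ζ⁻¹, ζ) ∈ M₄(ℂ) and let σ ∈ M₄(ℂ) be the matrix with rows (0,0,1,0), (0,0,0,1), (−1,0,0,0), (0,−1,0,0). Then (1/(4n)) · ( 6 · ( ∑_{j=1}^{2n−1} (tr(g^j) − 4)/det(g^j − 1) + ∑_{j=0}^{2n−1} (tr(σ·g^j) − 4)/det(σ·g^j − 1) ) + (4n − 1) ) = −(n + 2). -/
open Finset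

/-- If `w` is an `N`-th root of unity other than `1`, its geometric sum vanishes. -/
lemma geom_sum_eq_zero_of_pow_eq_one {K : Type*} [Field K] {N : ℕ} {w : K} (hw : w ^ N = 1)
    (hw1 : w ≠ 1) : ∑ k ∈ range N, w ^ k = 0 := by
  have h := mul_neg_geom_sum w N
  rw [hw, sub_self] at h
  exact (mul_eq_zero.mp h).resolve_left (sub_ne_zero.mpr hw1.symm)

/-- Summation by parts, twice, for the coefficients `k * (c - k)`. -/
lemma one_sub_sq_mul_sum_mul_sub_mul_pow {R : Type*} [CommRing R] (c w : R) (m : ℕ) :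
    (1 - w) ^ 2 * ∑ k ∈ range m, (k : R) * (c - k) * w ^ k =
      (c + 1) * w - 2 * w * ∑ k ∈ range m, w ^ k - m * (c - m) * w ^ m +
        (m - 1) * (c - m + 1) * w ^ (m + 1) := by
  induction m with
  | zero => simp; ring
  | succ m ih =>
    rw [sum_range_succ, sum_range_succ, mul_add, ih]
    push_cast
    ring

lemma one_sub_sq_mul_sum_of_pow_eq_one {K : Type*} [Field K] {N : ℕ} {w : K} (hw : w ^ N = 1)
    (hw1 : w ≠ 1) :
    (1 - w) ^ 2 * ∑ k ∈ range N, (k : K) * (N - k) * w ^ k = 2 * N * w := by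
  rw [one_sub_sq_mul_sum_mul_sub_mul_pow, geom_sum_eq_zero_of_pow_eq_one hw hw1, pow_succ, hw]
  ring

lemma six_mul_sum_range_mul_sub {R : Type*} [CommRing R] (c : R) (m : ℕ) :
    6 * ∑ k ∈ range m, (k : R) * (c - k) = m * (m - 1) * (3 * c - 2 * m + 1) := by
  induction m with
  | zero => simp
  | succ m ih =>
    rw [sum_range_succ, mul_add, ih]
    push_cast
    ring

/-- The values `∑ k, k (N - k) w ^ k` sum to zero over all `N`-th roots of unity `w`. -/
lemma sum_range_sum_mul_sub_mul_pow_eq_zero {K : Type*} [Field K] {N : ℕ} {ζ : K}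
    (hζ : IsPrimitiveRoot ζ N) :
    ∑ j ∈ range N, ∑ k ∈ range N, (k : K) * (N - k) * (ζ ^ j) ^ k = 0 := by
  rw [sum_comm]
  refine sum_eq_zero fun k hk => ?_
  rcases Nat.eq_zero_or_pos k with rfl | hk0
  · simp
  have h1 : ζ ^ k ≠ 1 := hζ.pow_ne_one_of_pos_of_lt hk0.ne' (mem_range.mp hk)
  have hN : (ζ ^ k) ^ N = 1 := by rw [pow_right_comm, hζ.pow_eq_one, one_pow]
  simp_rw [pow_right_comm ζ _ k, ← mul_sum, geom_sum_eq_zero_of_pow_eq_one hN h1, mul_zero]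

/-- The sum of `w / (1 - w) ^ 2` over the nontrivial `N`-th roots of unity `w`. -/
lemma IsPrimitiveRoot.sum_pow_div_one_sub_pow_sq {K : Type*} [Field K] [CharZero K] {N : ℕ}
    (hN : 0 < N) {ζ : K} (hζ : IsPrimitiveRoot ζ N) :
    ∑ j ∈ Ico 1 N, ζ ^ j / (1 - ζ ^ j) ^ 2 = -((N : K) ^ 2 - 1) / 12 := by
  have hN0 : (N : K) ≠ 0 := Nat.cast_ne_zero.mpr hN.ne'
  have hterm : ∀ j ∈ Ico 1 N, ζ ^ j / (1 - ζ ^ j) ^ 2 =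
      (∑ k ∈ range N, (k : K) * (N - k) * (ζ ^ j) ^ k) / (2 * N) := by
    intro j hj
    obtain ⟨hj1, hj2⟩ := mem_Ico.mp hj
    have h1 : ζ ^ j ≠ 1 := hζ.pow_ne_one_of_pos_of_lt (by omega) hj2
    have hw : (ζ ^ j) ^ N = 1 := by rw [pow_right_comm, hζ.pow_eq_one, one_pow]
    rw [div_eq_div_iff (pow_ne_zero 2 (sub_ne_zero.mpr h1.symm)) (by simpa using hN0)]
    linear_combination -one_sub_sq_mul_sum_of_pow_eq_one hw h1
  have hall := sum_range_sum_mul_sub_mul_pow_eq_zero hζ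
  rw [range_eq_Ico, sum_eq_sum_Ico_succ_bot hN, ← range_eq_Ico] at hall
  have h6 := six_mul_sum_range_mul_sub (N : K) N
  simp only [pow_zero, one_pow, mul_one, zero_add] at hall
  rw [sum_congr rfl hterm, ← sum_div, div_eq_div_iff (by simpa using hN0) (by norm_num)]
  linear_combination 12 * hall - 2 * h6

lemma trace_sub_four_div_det_diagonal_sub_one {K : Type*} [Field K] {w : K} (hw : w ≠ 0)
    (hw1 : w ≠ 1) :
    ((Matrix.diagonal ![w, w⁻¹, w⁻¹, w]).trace - 4) /
      (Matrix.diagonal ![w, w⁻¹, w⁻¹, w] - 1).det = 2 * (w / (1 - w) ^ 2) := by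
  have h1 : (1 - w) ≠ 0 := sub_ne_zero.mpr hw1.symm
  have hd : (Matrix.diagonal ![w, w⁻¹, w⁻¹, w] - 1).det = ((1 - w) ^ 2 / w) ^ 2 := by
    rw [← Matrix.diagonal_one, Matrix.diagonal_sub, Matrix.det_diagonal]
    simp [Fin.prod_univ_four]
    field_simp
    ring
  have ht : (Matrix.diagonal ![w, w⁻¹, w⁻¹, w]).trace - 4 = 2 * ((1 - w) ^ 2 / w) := by
    simp [Matrix.trace_diagonal, Fin.sum_univ_four]
    field_simp
    ring
  rw [hd, ht]
  field_simp

lemma trace_sub_four_div_det_mul_diagonal_sub_one {K : Type*} [Field K] [CharZero K] {w : K}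
    (hw : w ≠ 0) :
    ((!![0, 0, 1, 0; 0, 0, 0, 1; -1, 0, 0, 0; 0, -1, 0, 0] *
          Matrix.diagonal ![w, w⁻¹, w⁻¹, w]).trace - 4) /
      (!![0, 0, 1, 0; 0, 0, 0, 1; -1, 0, 0, 0; 0, -1, 0, 0] *
          Matrix.diagonal ![w, w⁻¹, w⁻¹, w] - 1).det = -1 := by
  have hm : !![0, 0, 1, 0; 0, 0, 0, 1; -1, 0, 0, 0; 0, -1, 0, 0] *
      Matrix.diagonal ![w, w⁻¹, w⁻¹, w] =
      !![0, 0, w⁻¹, 0; 0, 0, 0, w; -w, 0, 0, 0; 0, -w⁻¹, 0, 0] := by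
    ext i j
    fin_cases i <;> fin_cases j <;> simp [Matrix.mul_diagonal]
  have hd : (!![0, 0, w⁻¹, 0; 0, 0, 0, w; -w, 0, 0, 0; 0, -w⁻¹, 0, 0] - 1).det = 4 := by
    rw [Matrix.det_succ_row_zero]
    simp [Fin.sum_univ_four, Matrix.det_fin_three, Matrix.one_apply, Fin.succAbove]
    field_simp
    norm_num
  have ht : (!![0, 0, w⁻¹, 0; 0, 0, 0, w; -w, 0, 0, 0; 0, -w⁻¹, 0, 0]).trace = 0 := by
    simp [Matrix.trace, Fin.sum_univ_four]
  rw [hm, hd, ht]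
  norm_num

lemma diagonal_inv_pow {K : Type*} [Field K] (z : K) (j : ℕ) :
    Matrix.diagonal ![z, z⁻¹, z⁻¹, z] ^ j =
      Matrix.diagonal ![z ^ j, (z ^ j)⁻¹, (z ^ j)⁻¹, z ^ j] := by
  rw [Matrix.diagonal_pow]
  congr 1
  ext i
  fin_cases i <;> simp

open Matrix in
/-- Let `n ≥ 1` and let `ζ ∈ ℂ` be a primitive `2n`-th root of unity.
Let `g = diag(ζ, ζ⁻¹, ζ⁻¹, ζ)` and let `σ` be the matrix with rows `(0,0,1,0)`,
`(0,0,0,1)`, `(−1,0,0,0)`, `(0,−1,0,0)`.  Then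
`(1/(4n)) · (6·(∑_{j=1}^{2n−1} (tr(gʲ)−4)/det(gʲ−1) + ∑_{j=0}^{2n−1}
(tr(σgʲ)−4)/det(σgʲ−1)) + (4n−1)) = −(n+2)`. -/
theorem stmt11 (n : ℕ) (hn : 1 ≤ n) (ζ : ℂ) (hζ : IsPrimitiveRoot ζ (2 * n))
    (g σ : Matrix (Fin 4) (Fin 4) ℂ)
    (hg : g = Matrix.diagonal ![ζ, ζ⁻¹, ζ⁻¹, ζ])
    (hσ : σ = !![0, 0, 1, 0; 0, 0, 0, 1; -1, 0, 0, 0; 0, -1, 0, 0]) :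
    (1 / (4 * (n : ℂ))) *
      (6 * ((∑ j ∈ Finset.Ico 1 (2 * n), ((g ^ j).trace - 4) / ((g ^ j) - 1).det) +
            (∑ j ∈ Finset.range (2 * n), ((σ * g ^ j).trace - 4) / ((σ * g ^ j) - 1).det)) +
        (4 * (n : ℂ) - 1)) = -((n : ℂ) + 2) := by
  have hζ0 : ζ ≠ 0 := hζ.ne_zero (by omega)
  have hn0 : (n : ℂ) ≠ 0 := Nat.cast_ne_zero.mpr (by omega)
  subst hg hσ
  have hrot : ∀ j ∈ Finset.Ico 1 (2 * n),
      ((Matrix.diagonal ![ζ, ζ⁻¹, ζ⁻¹, ζ] ^ j).trace - 4) /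
        (Matrix.diagonal ![ζ, ζ⁻¹, ζ⁻¹, ζ] ^ j - 1).det = 2 * (ζ ^ j / (1 - ζ ^ j) ^ 2) := by
    intro j hj
    obtain ⟨hj1, hj2⟩ := Finset.mem_Ico.mp hj
    rw [diagonal_inv_pow]
    exact trace_sub_four_div_det_diagonal_sub_one (pow_ne_zero j hζ0)
      (hζ.pow_ne_one_of_pos_of_lt (by omega) hj2)
  rw [Finset.sum_congr rfl hrot, ← Finset.mul_sum, hζ.sum_pow_div_one_sub_pow_sq (by omega)]
  simp_rw [diagonal_inv_pow, trace_sub_four_div_det_mul_diagonal_sub_one (pow_ne_zero _ hζ0)]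
  simp only [Finset.sum_const, Finset.card_range, nsmul_eq_mul]
  push_cast
  field_simp
  ring
end

section
/- Let G be a group and n a natural number. Let 𝒢 be a subgroup of P_n(G) generated by a family of elements each of which has permutation part a transposition (i j) and tuple part the elementary element e_{i,j}(g) for some g ∈ G. Then every element of 𝒢 with trivial permutation part has its tuple part in the subgroup of (Fin n → G) generated by all elementary elements e_{i,j}(g) (for i ≠ j in Fin n and g ∈ G). -/
/-- If `H` is stable under the action `φ`, a subgroup of `N ⋊[φ] K` whose generators have left
component in `H` consists of elements with left component in `H`. -/
theorem SemidirectProduct.left_mem_of_mem_closure {N K : Type*} [Group N] [Group K]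
    {φ : K →* MulAut N} {H : Subgroup N} (hH : ∀ k, ∀ f ∈ H, φ k f ∈ H)
    {S : Set (SemidirectProduct N K φ)} (hS : ∀ s ∈ S, s.left ∈ H)
    {y : SemidirectProduct N K φ} (hy : y ∈ Subgroup.closure S) : y.left ∈ H := by
  induction hy using Subgroup.closure_induction with
  | mem s hs => exact hS s hs
  | one => exact H.one_mem
  | mul a b _ _ ha hb =>
    rw [SemidirectProduct.mul_left]
    exact H.mul_mem ha (hH _ _ hb)
  | inv a _ ha =>
    rw [SemidirectProduct.inv_left]
    exact hH _ _ (H.inv_mem ha)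

/-- An endomorphism preserving a set preserves the subgroup it generates. -/
theorem Subgroup.map_mem_closure_of_mapsTo {N : Type*} [Group N] {S : Set N} {φ : N →* N}
    (hφ : Set.MapsTo φ S S) {f : N} (hf : f ∈ Subgroup.closure S) :
    φ f ∈ Subgroup.closure S :=
  (Subgroup.closure_le ((Subgroup.closure S).comap φ)).2
    (fun _ hs => Subgroup.subset_closure (hφ hs)) hf

/-- Permuting the coordinates of the elementary tuple `e_{a,b}(h)` by `σ` gives
`e_{σ a,σ b}(h)`. -/
theorem permAut_elementary {G : Type*} [Group G] {n : ℕ} (σ : Equiv.Perm (Fin n))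
    (a b : Fin n) (h : G) :
    permAut G n σ (fun l => if l = a then h else if l = b then h⁻¹ else 1) =
      fun l => if l = σ a then h else if l = σ b then h⁻¹ else 1 := by
  funext l
  change (if σ.symm l = a then h else if σ.symm l = b then h⁻¹ else 1) = _
  simp only [Equiv.symm_apply_eq]

/-- Let `G` be a group and `n` a natural number.  Let `𝒢 ≤ P_n(G)` be
generated by a family of elements each of which has permutation part a transposition
`(i, j)` and tuple part the elementary element `e_{i,j}(g)` for some `g ∈ G`.  Then every
element of `𝒢` with trivial permutation part has its tuple part in the subgroup of
`Fin n → G` generated by all elementary elements. -/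
theorem stmt18 {G : Type*} [Group G] (n : ℕ) {ι : Type*}
    (i j : ι → Fin n) (g : ι → G) (hij : ∀ k : ι, i k ≠ j k)
    (x : ι → Pn G n)
    (hx : ∀ k : ι, x k =
      ⟨(fun l : Fin n => if l = i k then g k else if l = j k then (g k)⁻¹ else 1),
        Equiv.swap (i k) (j k)⟩)
    (𝒢 : Subgroup (Pn G n)) (h𝒢 : 𝒢 = Subgroup.closure (Set.range x))
    (E : Set (Fin n → G))
    (hE : E = {f : Fin n → G | ∃ (a b : Fin n) (h : G), a ≠ b ∧
      f = fun l => if l = a then h else if l = b then h⁻¹ else 1}) :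
    ∀ y ∈ 𝒢, y.right = 1 → y.left ∈ Subgroup.closure E := by
  subst h𝒢 hE
  intro y hy _
  refine SemidirectProduct.left_mem_of_mem_closure (fun σ f hf => ?_) ?_ hy
  · refine Subgroup.map_mem_closure_of_mapsTo (φ := (permAut G n σ).toMonoidHom) ?_ hf
    rintro _ ⟨a, b, h, hab, rfl⟩
    exact ⟨σ a, σ b, h, σ.injective.ne hab, permAut_elementary σ a b h⟩
  · rintro _ ⟨k, rfl⟩
    rw [hx k]
    exact Subgroup.subset_closure ⟨i k, j k, g k, hij k, rfl⟩
end
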